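/- arXiv:2205.14237 — 11 statements merged into one kernel-verified Lean document; each statement's English description precedes it below -/
import Mathlib

section
/- Let S and A be finite nonempty sets, η ∈ [0,1], R° : S×A → [0,1], T° : S×A → Δ(S), and V : S → ℝ. Define Q(s,a) = R°(s,a) + Σ_{s'} T°(s'|s,a)·V(s'). Then for every s ∈ S: (1−η)·max_a Q(s,a) + η·min_a Q(s,a) = max_{a∈A} inf_{(R,T)} [ R(s,a) + Σ_{s'} T(s'|s,a)·V(s') ], where the infimum (which is attained) ranges over all single-step η-perturbations (R,T) of (R°,T°). -/
/-- Robust Bellman backup identity: with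
`Q s a = R₀ s a + ∑ s', T₀ s a s' * V s'`, for every state `s`,
`(1-η) max_a Q(s,a) + η min_a Q(s,a)` equals the maximum over actions `a`
of the (attained) infimum of `R s a + ∑ s', T s a s' * V s'` over all
single-step η-perturbations `(R, T)` of `(R₀, T₀)`. -/
theorem stmt_1 {S A : Type*} [Fintype S] [Fintype A] [Nonempty S] [Nonempty A]
    (η : ℝ) (hη : η ∈ Set.Icc (0 : ℝ) 1)
    (R₀ : S → A → ℝ) (hR₀ : ∀ s a, R₀ s a ∈ Set.Icc (0 : ℝ) 1)
    (T₀ : S → A → S → ℝ) (hT₀nn : ∀ s a s', 0 ≤ T₀ s a s')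
    (hT₀sum : ∀ s a, ∑ s', T₀ s a s' = 1)
    (V : S → ℝ)
    (Q : S → A → ℝ) (hQ : ∀ s a, Q s a = R₀ s a + ∑ s', T₀ s a s' * V s')
    (s : S) :
    IsGreatest
      {v : ℝ | ∃ a : A,
        IsLeast
          {w : ℝ | ∃ (R : S → A → ℝ) (T : S → A → S → ℝ) (ξ : S → A → A → ℝ),
            (∀ s₁ a₁, (∀ a', 0 ≤ ξ s₁ a₁ a') ∧ (∑ a', ξ s₁ a₁ a') = 1 ∧
              1 - η ≤ ξ s₁ a₁ a₁) ∧
            (∀ s₁ a₁ s', T s₁ a₁ s' = ∑ a', T₀ s₁ a' s' * ξ s₁ a₁ a') ∧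
            (∀ s₁ a₁, R s₁ a₁ = ∑ a', R₀ s₁ a' * ξ s₁ a₁ a') ∧
            w = R s a + ∑ s', T s a s' * V s'} v}
      ((1 - η) * (Finset.univ.sup' Finset.univ_nonempty (Q s))
        + η * (Finset.univ.inf' Finset.univ_nonempty (Q s))) := by
  classical
  obtain ⟨hη0, hη1⟩ := hη
  obtain ⟨b, -, hb⟩ := Finset.exists_mem_eq_inf' (Finset.univ_nonempty (α := A)) (Q s)
  obtain ⟨c, -, hc⟩ := Finset.exists_mem_eq_sup' (Finset.univ_nonempty (α := A)) (Q s)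
  have hmin : ∀ a, Q s b ≤ Q s a := fun a => by
    rw [← hb]; exact Finset.inf'_le _ (Finset.mem_univ a)
  have hmax : ∀ a, Q s a ≤ Q s c := fun a => by
    rw [← hc]; exact Finset.le_sup' _ (Finset.mem_univ a)
  rw [hb, hc]
  have hlin : ∀ x : A → ℝ, (∑ a', R₀ s a' * x a') +
      ∑ s', (∑ a', T₀ s a' s' * x a') * V s' = ∑ a', Q s a' * x a' := by
    intro x
    simp_rw [hQ, add_mul, Finset.sum_add_distrib, Finset.sum_mul]
    rw [Finset.sum_comm]
    congr 1
    refine Finset.sum_congr rfl fun i _ => Finset.sum_congr rfl fun j _ => by ring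
  have key : ∀ a, IsLeast
          {w : ℝ | ∃ (R : S → A → ℝ) (T : S → A → S → ℝ) (ξ : S → A → A → ℝ),
            (∀ s₁ a₁, (∀ a', 0 ≤ ξ s₁ a₁ a') ∧ (∑ a', ξ s₁ a₁ a') = 1 ∧
              1 - η ≤ ξ s₁ a₁ a₁) ∧
            (∀ s₁ a₁ s', T s₁ a₁ s' = ∑ a', T₀ s₁ a' s' * ξ s₁ a₁ a') ∧
            (∀ s₁ a₁, R s₁ a₁ = ∑ a', R₀ s₁ a' * ξ s₁ a₁ a') ∧
            w = R s a + ∑ s', T s a s' * V s'} ((1 - η) * Q s a + η * Q s b) := by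
    intro a
    constructor
    · let ξ : S → A → A → ℝ := fun _ a₁ a' =>
        (1 - η) * (if a' = a₁ then 1 else 0) + η * (if a' = b then 1 else 0)
      refine ⟨fun s₁ a₁ => ∑ a', R₀ s₁ a' * ξ s₁ a₁ a',
        fun s₁ a₁ s' => ∑ a', T₀ s₁ a' s' * ξ s₁ a₁ a', ξ, ?_, fun _ _ _ => rfl,
        fun _ _ => rfl, ?_⟩
      · intro s₁ a₁
        have h1 : 0 ≤ 1 - η := by linarith
        refine ⟨fun a' => ?_, ?_, ?_⟩
        · simp only [ξ]; positivity
        · simp [ξ, Finset.sum_add_distrib]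
        · simp only [ξ, if_true, mul_one]
          have : 0 ≤ η * (if a₁ = b then (1 : ℝ) else 0) := by positivity
          linarith
      · rw [hlin (ξ s a)]
        simp [ξ, mul_add, Finset.sum_add_distrib]
        ring
    · rintro w ⟨R, T, ξ, hξ, hT, hR, rfl⟩
      simp_rw [hT, hR]
      rw [hlin (ξ s a)]
      obtain ⟨h0, h1, h2⟩ := hξ s a
      have h3 : (Q s a - Q s b) * ξ s a a ≤ ∑ a', (Q s a' - Q s b) * ξ s a a' :=
        Finset.single_le_sum (f := fun a' => (Q s a' - Q s b) * ξ s a a')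
          (fun i _ => mul_nonneg (sub_nonneg.2 (hmin i)) (h0 i)) (Finset.mem_univ a)
      have h4 : ∑ a', (Q s a' - Q s b) * ξ s a a' = ∑ a', Q s a' * ξ s a a' - Q s b := by
        simp_rw [sub_mul, Finset.sum_sub_distrib, ← Finset.mul_sum, h1, mul_one]
      have h5 := mul_le_mul_of_nonneg_left h2 (sub_nonneg.2 (hmin a))
      linarith
  refine ⟨⟨c, key c⟩, ?_⟩
  rintro v ⟨a, ha⟩
  rw [ha.unique (key a)]
  have := mul_le_mul_of_nonneg_left (hmax a) (sub_nonneg.2 hη1)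
  linarith
end

section
/- Let M° = (S,A,s_init,H,T°,R°) be a finite episodic MDP and η ∈ [0,1], and let Ṽ be the robust value function computed by robust dynamic programming on (M°,η). Then for every h ∈ {1,…,H+1} there exists an MDP M ∈ P(M°,η) such that Ṽ_h(s) = max_ψ V^ψ_{M,h}(s) for all s ∈ S; consequently, Ṽ_h(s) ≥ inf_{M ∈ P(M°,η)} max_ψ V^ψ_{M,h}(s) for all h and s. -/
/-- A finite episodic MDP: finite state space `S`, finite action space `A`,
initial state, horizon `H`, step-indexed transition probabilities and rewards
(steps are indexed `1, …, H`). -/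
structure FinMDP (S A : Type) [Fintype S] [Fintype A] where
  H : ℕ
  init : S
  T : ℕ → S → A → S → ℝ
  R : ℕ → S → A → ℝ
  T_nonneg : ∀ h s a s', 0 ≤ T h s a s'
  T_sum : ∀ h s a, ∑ s', T h s a s' = 1
  R_nonneg : ∀ h s a, 0 ≤ R h s a
  R_le_one : ∀ h s a, R h s a ≤ 1

/-- Auxiliary backward recursion: `valAux M ψ k` is the value function with `k`
steps remaining, i.e. at step `h = M.H + 1 - k`. -/
noncomputable def valAux {S A : Type} [Fintype S] [Fintype A]
    (M : FinMDP S A) (ψ : ℕ → S → A) : ℕ → S → ℝ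
  | 0, _ => 0
  | k + 1, s =>
      M.R (M.H - k) s (ψ (M.H - k) s)
        + ∑ s', M.T (M.H - k) s (ψ (M.H - k) s) s' * valAux M ψ k s'

/-- `val M ψ h s` is the value function `V^ψ_{M,h}(s)` of the abstract policy `ψ`:
`V^ψ_{M,H+1} = 0` and `V^ψ_{M,h}(s) = R_h(s,ψ_h(s)) + ∑ s', T_h(s'|s,ψ_h(s)) V^ψ_{M,h+1}(s')`. -/
noncomputable def val {S A : Type} [Fintype S] [Fintype A]
    (M : FinMDP S A) (ψ : ℕ → S → A) (h : ℕ) (s : S) : ℝ :=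
  valAux M ψ (M.H + 1 - h) s

/-- `M'` is an η-perturbation of `M`: same horizon and initial state, and there is a
noise kernel `ξ` with `ξ_h(a|s,a) ≥ 1-η` realizing `M'`'s transitions and rewards as
action-perturbed versions of `M`'s on every step `h ∈ {1,…,H}`. -/
def IsPerturbation {S A : Type} [Fintype S] [Fintype A] (η : ℝ)
    (M M' : FinMDP S A) : Prop :=
  M'.H = M.H ∧ M'.init = M.init ∧
  ∃ ξ : ℕ → S → A → A → ℝ,
    ∀ h ∈ Finset.Icc 1 M.H, ∀ (s : S) (a : A),
      (∀ a', 0 ≤ ξ h s a a') ∧ (∑ a', ξ h s a a') = 1 ∧ 1 - η ≤ ξ h s a a ∧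
      (∀ s', M'.T h s a s' = ∑ a', M.T h s a' s' * ξ h s a a') ∧
      M'.R h s a = ∑ a', M.R h s a' * ξ h s a a'

/-- Auxiliary robust dynamic programming recursion: `rdpAux M η k` is the robust
value function with `k` steps remaining, i.e. at step `h = M.H + 1 - k`. -/
noncomputable def rdpAux {S A : Type} [Fintype S] [Fintype A] [Nonempty A]
    (M : FinMDP S A) (η : ℝ) : ℕ → S → ℝ
  | 0, _ => 0
  | k + 1, s =>
      (1 - η) * (Finset.univ.sup' Finset.univ_nonempty (fun a : A =>
          M.R (M.H - k) s a + ∑ s', M.T (M.H - k) s a s' * rdpAux M η k s'))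
      + η * (Finset.univ.inf' Finset.univ_nonempty (fun a : A =>
          M.R (M.H - k) s a + ∑ s', M.T (M.H - k) s a s' * rdpAux M η k s'))

/-- `rdpV M η h s` is the robust value function `Ṽ_h(s)` computed by robust dynamic
programming: `Ṽ_{H+1} = 0` and `Ṽ_h(s) = (1-η) max_a Q̃_h(s,a) + η min_a Q̃_h(s,a)`. -/
noncomputable def rdpV {S A : Type} [Fintype S] [Fintype A] [Nonempty A]
    (M : FinMDP S A) (η : ℝ) (h : ℕ) (s : S) : ℝ :=
  rdpAux M η (M.H + 1 - h) s

/-- `rdpQ M η h s a = Q̃_h(s,a) = R_h(s,a) + ∑ s', T_h(s'|s,a) Ṽ_{h+1}(s')`. -/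
noncomputable def rdpQ {S A : Type} [Fintype S] [Fintype A] [Nonempty A]
    (M : FinMDP S A) (η : ℝ) (h : ℕ) (s : S) (a : A) : ℝ :=
  M.R h s a + ∑ s', M.T h s a s' * rdpV M η (h + 1) s'

/-- Robust Q-value at step `h`. -/
noncomputable def qq {S A : Type} [Fintype S] [Fintype A] [Nonempty A]
    (M : FinMDP S A) (η : ℝ) (h : ℕ) (s : S) (a : A) : ℝ :=
  M.R h s a + ∑ s', M.T h s a s' * rdpAux M η (M.H - h) s'

theorem exists_amin {S A : Type} [Fintype S] [Fintype A] [Nonempty A]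
    (M : FinMDP S A) (η : ℝ) : ∃ am : ℕ → S → A, ∀ h s,
      Finset.univ.inf' Finset.univ_nonempty (qq M η h s) = qq M η h s (am h s) := by
  have key : ∀ h s, ∃ a,
      Finset.univ.inf' Finset.univ_nonempty (qq M η h s) = qq M η h s a := fun h s => by
    obtain ⟨a, _, ha⟩ := Finset.exists_mem_eq_inf' Finset.univ_nonempty (qq M η h s)
    exact ⟨a, ha⟩
  choose am ham using key
  exact ⟨am, ham⟩

theorem exists_amax {S A : Type} [Fintype S] [Fintype A] [Nonempty A]
    (M : FinMDP S A) (η : ℝ) : ∃ am : ℕ → S → A, ∀ h s,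
      Finset.univ.sup' Finset.univ_nonempty (qq M η h s) = qq M η h s (am h s) := by
  have key : ∀ h s, ∃ a,
      Finset.univ.sup' Finset.univ_nonempty (qq M η h s) = qq M η h s a := fun h s => by
    obtain ⟨a, _, ha⟩ := Finset.exists_mem_eq_sup' Finset.univ_nonempty (qq M η h s)
    exact ⟨a, ha⟩
  choose am ham using key
  exact ⟨am, ham⟩

/-- The perturbed MDP mixing with the action `am h s` with weight `η`. -/
noncomputable def pert {S A : Type} [Fintype S] [Fintype A]
    (M : FinMDP S A) (η : ℝ) (h0 : 0 ≤ η) (h1 : η ≤ 1) (am : ℕ → S → A) : FinMDP S A where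
  H := M.H
  init := M.init
  T h s a s' := (1 - η) * M.T h s a s' + η * M.T h s (am h s) s'
  R h s a := (1 - η) * M.R h s a + η * M.R h s (am h s)
  T_nonneg h s a s' := add_nonneg
    (mul_nonneg (sub_nonneg.2 h1) (M.T_nonneg _ _ _ _)) (mul_nonneg h0 (M.T_nonneg _ _ _ _))
  T_sum h s a := by
    rw [Finset.sum_add_distrib, ← Finset.mul_sum, ← Finset.mul_sum, M.T_sum, M.T_sum]; ring
  R_nonneg h s a := add_nonneg
    (mul_nonneg (sub_nonneg.2 h1) (M.R_nonneg _ _ _)) (mul_nonneg h0 (M.R_nonneg _ _ _))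
  R_le_one h s a := by
    nlinarith [mul_nonneg (sub_nonneg.2 h1) (sub_nonneg.2 (M.R_le_one h s a)),
      mul_nonneg h0 (sub_nonneg.2 (M.R_le_one h s (am h s)))]

theorem pert_isPerturbation {S A : Type} [Fintype S] [Fintype A]
    (M : FinMDP S A) (η : ℝ) (h0 : 0 ≤ η) (h1 : η ≤ 1) (am : ℕ → S → A) :
    IsPerturbation η M (pert M η h0 h1 am) := by
  classical
  refine ⟨rfl, rfl, fun h s a a' =>
    (1 - η) * (if a' = a then 1 else 0) + η * (if a' = am h s then 1 else 0), ?_⟩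
  intro h _ s a
  have hs : 0 ≤ 1 - η := sub_nonneg.2 h1
  have gen : ∀ f : A → ℝ, ∑ a', f a' *
      ((1 - η) * (if a' = a then 1 else 0) + η * (if a' = am h s then 1 else 0))
      = (1 - η) * f a + η * f (am h s) := by
    intro f
    simp [mul_add, Finset.sum_add_distrib, mul_comm]
  refine ⟨fun a' => ?_, ?_, ?_, fun s' => ?_, ?_⟩
  · dsimp only
    split_ifs <;> simp <;> linarith
  · have := gen (fun _ => 1)
    simp only [one_mul] at this
    rw [this]; ring
  · simp only [if_true]
    split_ifs <;> simp <;> linarith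
  · exact (gen (fun a' => M.T h s a' s')).symm
  · exact (gen (fun a' => M.R h s a')).symm

theorem pert_q {S A : Type} [Fintype S] [Fintype A] [Nonempty A]
    (M : FinMDP S A) (η : ℝ) (h0 : 0 ≤ η) (h1 : η ≤ 1) (am : ℕ → S → A)
    (h : ℕ) (s : S) (a : A) :
    (pert M η h0 h1 am).R h s a
      + ∑ s', (pert M η h0 h1 am).T h s a s' * rdpAux M η (M.H - h) s'
    = (1 - η) * qq M η h s a + η * qq M η h s (am h s) := by
  simp only [pert, qq, add_mul, Finset.sum_add_distrib, mul_assoc, ← Finset.mul_sum]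
  ring

theorem rdpAux_succ_qq {S A : Type} [Fintype S] [Fintype A] [Nonempty A]
    (M : FinMDP S A) (η : ℝ) (k : ℕ) (hk : k + 1 ≤ M.H) (s : S) :
    rdpAux M η (k + 1) s
      = (1 - η) * Finset.univ.sup' Finset.univ_nonempty (qq M η (M.H - k) s)
        + η * Finset.univ.inf' Finset.univ_nonempty (qq M η (M.H - k) s) := by
  have e : M.H - (M.H - k) = k := by omega
  unfold qq
  rw [rdpAux, e]

theorem valAux_pert_le {S A : Type} [Fintype S] [Fintype A] [Nonempty A]
    (M : FinMDP S A) (η : ℝ) (h0 : 0 ≤ η) (h1 : η ≤ 1) (am : ℕ → S → A)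
    (ham : ∀ h s, Finset.univ.inf' Finset.univ_nonempty (qq M η h s) = qq M η h s (am h s))
    (ψ : ℕ → S → A) (k : ℕ) (hk : k ≤ M.H) (s : S) :
    valAux (pert M η h0 h1 am) ψ k s ≤ rdpAux M η k s := by
  induction k generalizing s with
  | zero => simp [valAux, rdpAux]
  | succ k ih =>
    have e : M.H - (M.H - k) = k := by omega
    have hq := pert_q M η h0 h1 am (M.H - k) s (ψ (M.H - k) s)
    rw [e] at hq
    rw [rdpAux_succ_qq M η k hk, ham, valAux]
    change (pert M η h0 h1 am).R (M.H - k) s (ψ (M.H - k) s) + ∑ s',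
      (pert M η h0 h1 am).T (M.H - k) s (ψ (M.H - k) s) s' * _ ≤ _
    have hle := Finset.sum_le_sum (s := Finset.univ) fun s' _ => mul_le_mul_of_nonneg_left
      (ih (by omega) s') ((pert M η h0 h1 am).T_nonneg (M.H - k) s (ψ (M.H - k) s) s')
    have hsup := mul_le_mul_of_nonneg_left
      (Finset.le_sup' (qq M η (M.H - k) s) (Finset.mem_univ (ψ (M.H - k) s)))
      (sub_nonneg.2 h1)
    linarith

theorem valAux_pert_eq {S A : Type} [Fintype S] [Fintype A] [Nonempty A]
    (M : FinMDP S A) (η : ℝ) (h0 : 0 ≤ η) (h1 : η ≤ 1) (am : ℕ → S → A)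
    (ham : ∀ h s, Finset.univ.inf' Finset.univ_nonempty (qq M η h s) = qq M η h s (am h s))
    (ψ : ℕ → S → A)
    (hψ : ∀ h s, Finset.univ.sup' Finset.univ_nonempty (qq M η h s) = qq M η h s (ψ h s))
    (k : ℕ) (hk : k ≤ M.H) (s : S) :
    valAux (pert M η h0 h1 am) ψ k s = rdpAux M η k s := by
  induction k generalizing s with
  | zero => simp [valAux, rdpAux]
  | succ k ih =>
    have e : M.H - (M.H - k) = k := by omega
    have hq := pert_q M η h0 h1 am (M.H - k) s (ψ (M.H - k) s)
    rw [e] at hq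
    rw [rdpAux_succ_qq M η k hk, ham, hψ, valAux, ← hq]
    simp only [fun s' => ih (by omega) s']
    rfl

theorem valAux_nonneg {S A : Type} [Fintype S] [Fintype A]
    (M : FinMDP S A) (ψ : ℕ → S → A) (k : ℕ) (s : S) : 0 ≤ valAux M ψ k s := by
  induction k generalizing s with
  | zero => simp [valAux]
  | succ k ih =>
    rw [valAux]
    exact add_nonneg (M.R_nonneg _ _ _)
      (Finset.sum_nonneg fun s' _ => mul_nonneg (M.T_nonneg _ _ _ _) (ih s'))

/-- For every step `h ∈ {1,…,H+1}` there is an η-perturbation `M` of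
`M₀` whose optimal value function at step `h` agrees with the robust value function
`Ṽ_h` everywhere; consequently `Ṽ_h(s) ≥ inf_{M ∈ P(M₀,η)} max_ψ V^ψ_{M,h}(s)`. -/
theorem stmt_3 {S A : Type} [Fintype S] [Fintype A] [Nonempty S] [Nonempty A]
    (M₀ : FinMDP S A) (η : ℝ) (hη : η ∈ Set.Icc (0 : ℝ) 1) :
    (∀ h ∈ Finset.Icc 1 (M₀.H + 1),
      ∃ M : FinMDP S A, IsPerturbation η M₀ M ∧
        ∀ s : S, rdpV M₀ η h s = ⨆ ψ : ℕ → S → A, val M ψ h s) ∧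
    (∀ h ∈ Finset.Icc 1 (M₀.H + 1), ∀ s : S,
      (⨅ M : {M : FinMDP S A // IsPerturbation η M₀ M},
          ⨆ ψ : ℕ → S → A, val M.1 ψ h s) ≤ rdpV M₀ η h s) := by
  have main : ∀ h ∈ Finset.Icc 1 (M₀.H + 1),
      ∃ M : FinMDP S A, IsPerturbation η M₀ M ∧
        ∀ s : S, rdpV M₀ η h s = ⨆ ψ : ℕ → S → A, val M ψ h s := by
    intro h hh
    rw [Finset.mem_Icc] at hh
    obtain ⟨am, ham⟩ := exists_amin M₀ η
    obtain ⟨ax, hax⟩ := exists_amax M₀ η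
    refine ⟨pert M₀ η hη.1 hη.2 am, pert_isPerturbation M₀ η hη.1 hη.2 am, fun s => ?_⟩
    have hk : M₀.H + 1 - h ≤ M₀.H := by omega
    have hle : ∀ ψ : ℕ → S → A, val (pert M₀ η hη.1 hη.2 am) ψ h s ≤ rdpV M₀ η h s :=
      fun ψ => valAux_pert_le M₀ η hη.1 hη.2 am ham ψ _ hk s
    have heq : val (pert M₀ η hη.1 hη.2 am) ax h s = rdpV M₀ η h s :=
      valAux_pert_eq M₀ η hη.1 hη.2 am ham ax hax _ hk s
    haveI : Nonempty (ℕ → S → A) := ⟨ax⟩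
    refine le_antisymm ?_ (ciSup_le hle)
    rw [← heq]
    exact le_ciSup (f := fun ψ : ℕ → S → A => val (pert M₀ η hη.1 hη.2 am) ψ h s)
      ⟨rdpV M₀ η h s, by rintro _ ⟨ψ, rfl⟩; exact hle ψ⟩ ax
  refine ⟨main, fun h hh s => ?_⟩
  obtain ⟨M, hM, hV⟩ := main h hh
  rw [hV s]
  refine ciInf_le (f := fun M : {M : FinMDP S A // IsPerturbation η M₀ M} =>
    ⨆ ψ : ℕ → S → A, val M.1 ψ h s) ⟨0, ?_⟩ ⟨M, hM⟩
  rintro _ ⟨M', rfl⟩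
  exact Real.iSup_nonneg fun ψ => valAux_nonneg _ _ _ _
end

section
/- Let M° = (S,A,s_init,H,T°,R°) be a finite episodic MDP, η ∈ [0,1], and let Ṽ and Q̃ be computed by robust dynamic programming on (M°,η). Let ρ be any policy with ρ_h(s) ∈ argmax_a Q̃_h(s,a) for all h,s. Then for every M ∈ P(M°,η), every h ∈ {1,…,H+1} and every s ∈ S: V^ρ_{M,h}(s) ≥ Ṽ_h(s). -/
/-- Any policy `ρ` that is greedy with respect to `Q̃` satisfies
`V^ρ_{M,h}(s) ≥ Ṽ_h(s)` for every η-perturbation `M` of `M₀`, every step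
`h ∈ {1,…,H+1}` and every state `s`. -/
theorem stmt_4 {S A : Type} [Fintype S] [Fintype A] [Nonempty S] [Nonempty A]
    (M₀ : FinMDP S A) (η : ℝ) (hη : η ∈ Set.Icc (0 : ℝ) 1)
    (ρ : ℕ → S → A)
    (hρ : ∀ h ∈ Finset.Icc 1 M₀.H, ∀ (s : S) (a : A),
      rdpQ M₀ η h s a ≤ rdpQ M₀ η h s (ρ h s)) :
    ∀ M : FinMDP S A, IsPerturbation η M₀ M →
      ∀ h ∈ Finset.Icc 1 (M₀.H + 1), ∀ s : S,
        rdpV M₀ η h s ≤ val M ρ h s := by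
  rintro M ⟨hH, -, ξ, hξ⟩
  have key : ∀ k, k ≤ M₀.H → ∀ s, rdpAux M₀ η k s ≤ valAux M ρ k s := by
    intro k
    induction k with
    | zero => intro _ s; simp [rdpAux, valAux]
    | succ k ih =>
      intro hk s
      have ih' := ih (by omega)
      have hmem : M₀.H - k ∈ Finset.Icc 1 M₀.H := by
        rw [Finset.mem_Icc]; omega
      have hr := hρ _ hmem s
      have e : M₀.H + 1 - (M₀.H - k + 1) = k := by omega
      simp only [rdpQ, rdpV, e] at hr
      obtain ⟨h0, h1, h2, hT, hR⟩ := hξ _ hmem s (ρ (M₀.H - k) s)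
      have hTn : ∀ s', 0 ≤ M.T (M₀.H - k) s (ρ (M₀.H - k) s) s' :=
        fun s' => M.T_nonneg _ _ _ _
      simp only [rdpAux, valAux, hH]
      generalize M₀.H - k = h at *
      generalize hQ : (fun a : A => M₀.R h s a + ∑ s', M₀.T h s a s' * rdpAux M₀ η k s') = Q
      have hQa : ∀ a, M₀.R h s a + ∑ s', M₀.T h s a s' * rdpAux M₀ η k s' = Q a :=
        fun a => congrFun hQ a
      simp only [hQa] at hr
      have hsup : Finset.univ.sup' Finset.univ_nonempty Q ≤ Q (ρ h s) :=
        Finset.sup'_le _ _ (fun a _ => hr a)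
      have hinf : ∀ a, Finset.univ.inf' Finset.univ_nonempty Q ≤ Q a :=
        fun a => Finset.inf'_le _ (Finset.mem_univ a)
      generalize Finset.univ.sup' Finset.univ_nonempty Q = u at *
      generalize Finset.univ.inf' Finset.univ_nonempty Q = m at *
      have step1 : M.R h s (ρ h s) + ∑ s', M.T h s (ρ h s) s' * rdpAux M₀ η k s'
          ≤ M.R h s (ρ h s) + ∑ s', M.T h s (ρ h s) s' * valAux M ρ k s' := by
        gcongr with s' _
        · exact hTn s'
        · exact ih' s'
      have step2 : M.R h s (ρ h s) + ∑ s', M.T h s (ρ h s) s' * rdpAux M₀ η k s'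
          = ∑ a, ξ h s (ρ h s) a * Q a := by
        simp only [hR, hT, ← hQa, mul_add, Finset.sum_add_distrib, Finset.sum_mul,
          Finset.mul_sum]
        rw [Finset.sum_comm (s := (Finset.univ : Finset S))]
        congr 1
        · exact Finset.sum_congr rfl fun a _ => mul_comm _ _
        · exact Finset.sum_congr rfl fun a _ => Finset.sum_congr rfl fun s' _ => by ring
      have step3 : ξ h s (ρ h s) (ρ h s) * (Q (ρ h s) - m)
          ≤ ∑ a, ξ h s (ρ h s) a * (Q a - m) :=
        Finset.single_le_sum (f := fun a => ξ h s (ρ h s) a * (Q a - m))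
          (fun a _ => mul_nonneg (h0 a) (sub_nonneg.2 (hinf a))) (Finset.mem_univ _)
      have step4 : ∑ a, ξ h s (ρ h s) a * (Q a - m) = ∑ a, ξ h s (ρ h s) a * Q a - m := by
        simp only [mul_sub, Finset.sum_sub_distrib, ← Finset.sum_mul, h1, one_mul]
      have step5 := mul_le_mul_of_nonneg_right h2 (sub_nonneg.2 (hinf (ρ h s)))
      have step6 := mul_le_mul_of_nonneg_left hsup (sub_nonneg.2 hη.2)
      linarith
  intro h hh s
  rw [Finset.mem_Icc] at hh
  simp only [rdpV, val, hH]
  exact key _ (by omega) s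
end

section
/- Let X and A be finite nonempty sets and Pr a probability mass function on X×A×X whose conditional distribution of a given (x,x') is f*(a|x,x') = Pr(x,a,x') / Σ_{a'} Pr(x,a',x') (defined where the denominator is positive). Let F be a finite class of conditional distributions f : X×X → Δ(A) with f* ∈ F. Let (x_1,a_1,x'_1),…,(x_n,a_n,x'_n) be drawn i.i.d. from Pr, and let f̂ ∈ argmax_{f∈F} Σ_{i=1}^n ln f(a_i|x_i,x'_i) be a maximizer of the empirical log-likelihood. Then for every δ ∈ (0,1), with probability at least 1−δ over the sample: E_{(x,x')}[ ‖f̂(·|x,x') − f*(·|x,x')‖_TV² ] ≤ 2·ln(|F|/δ)/n, where the expectation is over the marginal distribution of (x,x') under Pr. -/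
lemma aux_tv {A : Type*} [Fintype A] (p q : A → ℝ) (hp : ∀ a, 0 ≤ p a) (hq : ∀ a, 0 ≤ q a)
    (sp : ∑ a, p a = 1) (sq : ∑ a, q a = 1) :
    ∑ a, √(p a) * √(q a) ≤ 1 - ((1 / 2) * ∑ a, |p a - q a|) ^ 2 / 2 := by
  have h1 : ∑ a, (√(p a) - √(q a)) ^ 2 = 2 - 2 * ∑ a, √(p a) * √(q a) := by
    have : ∀ a, (√(p a) - √(q a)) ^ 2 = p a + q a - 2 * (√(p a) * √(q a)) := fun a => by
      linear_combination Real.sq_sqrt (hp a) + Real.sq_sqrt (hq a)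
    simp only [this, Finset.sum_sub_distrib, Finset.sum_add_distrib, ← Finset.mul_sum, sp, sq]
    ring
  have h2 : ∑ a, (√(p a) + √(q a)) ^ 2 = 2 + 2 * ∑ a, √(p a) * √(q a) := by
    have : ∀ a, (√(p a) + √(q a)) ^ 2 = p a + q a + 2 * (√(p a) * √(q a)) := fun a => by
      linear_combination Real.sq_sqrt (hp a) + Real.sq_sqrt (hq a)
    simp only [this, Finset.sum_add_distrib, ← Finset.mul_sum, sp, sq]
    ring
  have h3 : 0 ≤ ∑ a, (√(p a) - √(q a)) ^ 2 := Finset.sum_nonneg fun a _ => sq_nonneg _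
  have h4 : ∑ a, |p a - q a| = ∑ a, |√(p a) - √(q a)| * (√(p a) + √(q a)) := by
    refine Finset.sum_congr rfl fun a _ => ?_
    rw [← abs_of_nonneg (show 0 ≤ √(p a) + √(q a) by positivity), ← abs_mul]
    congr 1
    linear_combination -Real.sq_sqrt (hp a) + Real.sq_sqrt (hq a)
  have h5 := Finset.sum_mul_sq_le_sq_mul_sq Finset.univ (fun a => |√(p a) - √(q a)|)
    (fun a => √(p a) + √(q a))
  simp only [sq_abs] at h5
  rw [← h4, h1, h2] at h5
  rw [h1] at h3
  nlinarith

/-- MLE concentration for inverse dynamics: if `F` is a finite class of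
conditional action distributions containing the true conditional `f*` of the pmf `Pr` on
`X × A × X`, and `f̂` is any maximizer of the empirical likelihood on an i.i.d. sample of
size `n` from `Pr`, then with probability at least `1 - δ` over the sample (the sample
space is `Fin n → X × A × X` with the i.i.d. product weights), the expected squared total
variation distance between `f̂` and `f*` over the marginal of `(x,x')` is at most
`2 ln(|F|/δ)/n`. -/
theorem stmt_8 {X A : Type*} [Fintype X] [Fintype A] [Nonempty X] [Nonempty A]
    (Pr : X → A → X → ℝ) (hPrnn : ∀ x a x', 0 ≤ Pr x a x')
    (hPrsum : ∑ x, ∑ a, ∑ x', Pr x a x' = 1)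
    (F : Finset (X → X → A → ℝ))
    (hF : ∀ f ∈ F, (∀ x x' a, 0 ≤ f x x' a) ∧ (∀ x x', ∑ a, f x x' a = 1))
    (fstar : X → X → A → ℝ) (hfstarF : fstar ∈ F)
    (hfstar : ∀ x x', 0 < (∑ a', Pr x a' x') →
      ∀ a, fstar x x' a = Pr x a x' / ∑ a', Pr x a' x')
    (n : ℕ) (hn : 0 < n)
    (fhat : (Fin n → X × A × X) → (X → X → A → ℝ))
    (hfhat : ∀ ω : Fin n → X × A × X, fhat ω ∈ F ∧
      ∀ f ∈ F, (∏ i, f (ω i).1 (ω i).2.2 (ω i).2.1)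
        ≤ ∏ i, (fhat ω) (ω i).1 (ω i).2.2 (ω i).2.1)
    (δ : ℝ) (hδ : δ ∈ Set.Ioo (0 : ℝ) 1) :
    1 - δ ≤
      ∑ ω : Fin n → X × A × X,
        (if (∑ x, ∑ x', (∑ a, Pr x a x') *
              ((1 / 2) * ∑ a, |(fhat ω) x x' a - fstar x x' a|) ^ 2)
            ≤ 2 * Real.log ((F.card : ℝ) / δ) / n
         then ∏ i, Pr (ω i).1 (ω i).2.1 (ω i).2.2 else 0) := by
  classical
  obtain ⟨hδ0, hδ1⟩ := hδ
  set m : X → X → ℝ := fun x x' => ∑ a, Pr x a x' with hm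
  set D : (X → X → A → ℝ) → ℝ := fun f => ∑ x, ∑ x', m x x' *
    ((1 / 2) * ∑ a, |f x x' a - fstar x x' a|) ^ 2 with hD
  set t : ℝ := 2 * Real.log ((F.card : ℝ) / δ) / n with ht
  have hm0 : ∀ x x', 0 ≤ m x x' := fun x x' => Finset.sum_nonneg fun a _ => hPrnn x a x'
  have hmsum : ∑ x, ∑ x', m x x' = 1 := by
    rw [← hPrsum]
    exact Finset.sum_congr rfl fun x _ => Finset.sum_comm
  have hPr : ∀ x a x', Pr x a x' = m x x' * fstar x x' a := by
    intro x a x'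
    rcases (hm0 x x').lt_or_eq with h | h
    · rw [hfstar x x' h a, mul_div_cancel₀ _ h.ne']
    · rw [← h, zero_mul]
      exact (Finset.sum_eq_zero_iff_of_nonneg (fun a _ => hPrnn x a x')).1 h.symm a
        (Finset.mem_univ a)
  have hs := hF fstar hfstarF
  let w : (X → X → A → ℝ) → X × A × X → ℝ := fun f z =>
    m z.1 z.2.2 * (√(f z.1 z.2.2 z.2.1) * √(fstar z.1 z.2.2 z.2.1))
  have hw0 : ∀ f z, 0 ≤ w f z := fun f z => mul_nonneg (hm0 _ _) (by positivity)
  have hw1 : ∀ f ∈ F, ∑ z, w f z ≤ Real.exp (-(D f / 2)) := by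
    intro f hf
    have h1 : ∑ z, w f z = ∑ x, ∑ x', m x x' * ∑ a, √(f x x' a) * √(fstar x x' a) := by
      simp only [w, Fintype.sum_prod_type, Finset.mul_sum]
      exact Finset.sum_congr rfl fun x _ => Finset.sum_comm
    have h2 : ∑ z, w f z ≤ ∑ x, ∑ x', (m x x' - m x x' *
        ((1 / 2) * ∑ a, |f x x' a - fstar x x' a|) ^ 2 / 2) := by
      rw [h1]
      refine Finset.sum_le_sum fun x _ => Finset.sum_le_sum fun x' _ => ?_
      have := mul_le_mul_of_nonneg_left (aux_tv (f x x') (fstar x x') ((hF f hf).1 x x')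
        (hs.1 x x') ((hF f hf).2 x x') (hs.2 x x')) (hm0 x x')
      linarith
    have h3 : ∑ x, ∑ x', (m x x' - m x x' *
        ((1 / 2) * ∑ a, |f x x' a - fstar x x' a|) ^ 2 / 2) = 1 - D f / 2 := by
      simp only [Finset.sum_sub_distrib, hmsum, ← Finset.sum_div, hD]
    have h4 := Real.add_one_le_exp (-(D f / 2))
    linarith
  have hFpos : (0 : ℝ) < F.card := by
    exact_mod_cast Finset.card_pos.2 ⟨fstar, hfstarF⟩
  have hn' : (0 : ℝ) < n := by exact_mod_cast hn
  have hW : ∀ f ∈ F, t < D f → ∑ ω : Fin n → X × A × X, ∏ i, w f (ω i) ≤ δ / F.card := by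
    intro f hf hlt
    rw [← Fintype.sum_pow]
    calc (∑ z, w f z) ^ n ≤ (Real.exp (-(D f / 2))) ^ n :=
          pow_le_pow_left₀ (Finset.sum_nonneg fun z _ => hw0 f z) (hw1 f hf) n
      _ = Real.exp (n * (-(D f / 2))) := (Real.exp_nat_mul _ _).symm
      _ ≤ Real.exp (-Real.log ((F.card : ℝ) / δ)) := by
          apply Real.exp_le_exp.2
          rw [ht, div_lt_iff₀ hn'] at hlt
          linarith
      _ = δ / F.card := by
          rw [Real.exp_neg, Real.exp_log (div_pos hFpos hδ0), inv_div]
  have hPsum : ∑ ω : Fin n → X × A × X, ∏ i, Pr (ω i).1 (ω i).2.1 (ω i).2.2 = 1 := by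
    have := Fintype.sum_pow (fun z : X × A × X => Pr z.1 z.2.1 z.2.2) n
    rw [← this]
    simp only [Fintype.sum_prod_type, hPrsum, one_pow]
  have hkey : ∀ ω : Fin n → X × A × X, ∏ i, Pr (ω i).1 (ω i).2.1 (ω i).2.2 ≤
      (if D (fhat ω) ≤ t then ∏ i, Pr (ω i).1 (ω i).2.1 (ω i).2.2 else 0) +
      ∑ f ∈ F, if t < D f then ∏ i, w f (ω i) else 0 := by
    intro ω
    have hnn : ∀ f ∈ F, 0 ≤ if t < D f then ∏ i, w f (ω i) else 0 := by
      intro f _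
      split_ifs
      · exact Finset.prod_nonneg fun i _ => hw0 f _
      · exact le_rfl
    by_cases h : D (fhat ω) ≤ t
    · rw [if_pos h]
      linarith [Finset.sum_nonneg hnn]
    · rw [if_neg h, zero_add]
      have h1 := Finset.single_le_sum hnn (hfhat ω).1
      rw [if_pos (not_le.1 h)] at h1
      refine le_trans ?_ h1
      have h2 := Real.sqrt_le_sqrt ((hfhat ω).2 fstar hfstarF)
      have hp1 : √(∏ i, fstar (ω i).1 (ω i).2.2 (ω i).2.1) =
          ∏ i, √(fstar (ω i).1 (ω i).2.2 (ω i).2.1) :=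
        Real.sqrt_prod _ fun i _ => hs.1 _ _ _
      have hp2 : √(∏ i, fhat ω (ω i).1 (ω i).2.2 (ω i).2.1) =
          ∏ i, √(fhat ω (ω i).1 (ω i).2.2 (ω i).2.1) :=
        Real.sqrt_prod _ fun i _ => (hF _ (hfhat ω).1).1 _ _ _
      rw [hp1, hp2] at h2
      have h3 : ∏ i, Pr (ω i).1 (ω i).2.1 (ω i).2.2 = (∏ i, m (ω i).1 (ω i).2.2) *
          ((∏ i, √(fstar (ω i).1 (ω i).2.2 (ω i).2.1)) *
            ∏ i, √(fstar (ω i).1 (ω i).2.2 (ω i).2.1)) := by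
        rw [← Finset.prod_mul_distrib, ← Finset.prod_mul_distrib]
        refine Finset.prod_congr rfl fun i _ => ?_
        rw [Real.mul_self_sqrt (hs.1 _ _ _), hPr]
      rw [h3]
      simp only [w, Finset.prod_mul_distrib]
      exact mul_le_mul_of_nonneg_left (mul_le_mul_of_nonneg_right h2
        (Finset.prod_nonneg fun i _ => Real.sqrt_nonneg _))
        (Finset.prod_nonneg fun i _ => hm0 _ _)
  have hfin := Finset.sum_le_sum fun ω (_ : ω ∈ Finset.univ) => hkey ω
  rw [hPsum, Finset.sum_add_distrib, Finset.sum_comm] at hfin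
  have hb : ∑ f ∈ F, ∑ ω : Fin n → X × A × X, (if t < D f then ∏ i, w f (ω i) else 0) ≤ δ := by
    calc _ ≤ ∑ f ∈ F, δ / F.card := by
          refine Finset.sum_le_sum fun f hf => ?_
          by_cases h : t < D f
          · simp only [if_pos h]
            exact hW f hf h
          · simp only [if_neg h, Finset.sum_const_zero]
            exact (div_pos hδ0 hFpos).le
      _ = δ := by
          rw [Finset.sum_const, nsmul_eq_mul, mul_div_cancel₀ _ hFpos.ne']
  have hgoal : 1 - δ ≤ ∑ ω : Fin n → X × A × X,
      (if D (fhat ω) ≤ t then ∏ i, Pr (ω i).1 (ω i).2.1 (ω i).2.2 else 0) := by linarith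
  convert hgoal using 3
end

section
/- Let S and A be finite nonempty sets, η ∈ [0, 1/2), T° : S×A → S a deterministic transition map, and ξ : S×A → Δ(A) with ξ(a|s,a) ≥ 1−η for all s,a. Define the perturbed transition T*(s'|s,a) = Σ_{a'∈A} 1{T°(s,a') = s'}·ξ(a'|s,a). Fix s, s' ∈ S and suppose a₁ ∈ A satisfies T°(s,a₁) = s' and a₂ ∈ A satisfies T°(s,a₂) ≠ s'. Then (i) T*(s'|s,a₁) − T*(s'|s,a₂) ≥ 1−2η, and (ii) the normalized posterior f*(a) = T*(s'|s,a) / Σ_{a'} T*(s'|s,a') (well-defined since the denominator is at least 1−η > 0) satisfies f*(a₁) − f*(a₂) ≥ (1−2η)/|A|. -/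
/-- Margin of shadow actions in the inverse-dynamics posterior: if the
target transition `T*` is an η-perturbation (via noise kernel `ξ`) of a deterministic map
`T₀` and `η < 1/2`, then for `a₁` with `T₀ s a₁ = s'` and `a₂` with `T₀ s a₂ ≠ s'` we
have (i) `T*(s'|s,a₁) − T*(s'|s,a₂) ≥ 1 − 2η`, and (ii) the posterior
`f*(a) = T*(s'|s,a) / ∑_{a'} T*(s'|s,a')` is well defined (the denominator is at least
`1 − η > 0`) and satisfies `f*(a₁) − f*(a₂) ≥ (1 − 2η)/|A|`. -/
theorem stmt_9 {S A : Type*} [Fintype A] [Nonempty A] [DecidableEq S]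
    (η : ℝ) (hη0 : 0 ≤ η) (hη : η < 1 / 2)
    (T₀ : S → A → S)
    (ξ : S → A → A → ℝ) (hξnn : ∀ s a a', 0 ≤ ξ s a a')
    (hξsum : ∀ s a, ∑ a', ξ s a a' = 1) (hξdiag : ∀ s a, 1 - η ≤ ξ s a a)
    (Tstar : S → A → S → ℝ)
    (hTstar : ∀ s a s',
      Tstar s a s' = ∑ a', (if T₀ s a' = s' then (1 : ℝ) else 0) * ξ s a a')
    (s s' : S) (a₁ a₂ : A) (h₁ : T₀ s a₁ = s') (h₂ : T₀ s a₂ ≠ s') :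
    1 - 2 * η ≤ Tstar s a₁ s' - Tstar s a₂ s' ∧
    1 - η ≤ (∑ a', Tstar s a' s') ∧
    (1 - 2 * η) / (Fintype.card A : ℝ) ≤
      Tstar s a₁ s' / (∑ a', Tstar s a' s')
        - Tstar s a₂ s' / (∑ a', Tstar s a' s') := by
  have hnn : ∀ a, 0 ≤ Tstar s a s' := by
    intro a
    rw [hTstar]
    refine Finset.sum_nonneg fun a' _ => mul_nonneg ?_ (hξnn s a a')
    split_ifs <;> norm_num
  have hle : ∀ a, Tstar s a s' ≤ 1 := by
    intro a
    rw [hTstar]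
    refine le_trans ?_ (hξsum s a).le
    refine Finset.sum_le_sum fun a' _ => ?_
    have := hξnn s a a'
    split_ifs <;> linarith
  have hb1 : 1 - η ≤ Tstar s a₁ s' := by
    refine (hξdiag s a₁).trans ?_
    rw [hTstar]
    have := Finset.single_le_sum
      (f := fun a' => (if T₀ s a' = s' then (1 : ℝ) else 0) * ξ s a₁ a')
      (fun a' _ => mul_nonneg (by split_ifs <;> norm_num) (hξnn s a₁ a'))
      (Finset.mem_univ a₁)
    simpa only [h₁, if_true, one_mul] using this
  have hb2 : Tstar s a₂ s' ≤ η := by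
    have hc : ξ s a₂ a₂ ≤ ∑ a', (1 - (if T₀ s a' = s' then (1 : ℝ) else 0)) * ξ s a₂ a' := by
      have := Finset.single_le_sum
        (f := fun a' => (1 - (if T₀ s a' = s' then (1 : ℝ) else 0)) * ξ s a₂ a')
        (fun a' _ => mul_nonneg (by split_ifs <;> norm_num) (hξnn s a₂ a'))
        (Finset.mem_univ a₂)
      simpa only [h₂, if_false, sub_zero, one_mul] using this
    simp only [sub_mul, one_mul, Finset.sum_sub_distrib] at hc
    rw [hξsum] at hc
    simp only [hTstar, one_mul, ite_mul, zero_mul] at hc ⊢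
    have := hξdiag s a₂
    linarith
  have hD1 : 1 - η ≤ ∑ a', Tstar s a' s' :=
    hb1.trans (Finset.single_le_sum (f := fun a' => Tstar s a' s')
      (fun a _ => hnn a) (Finset.mem_univ a₁))
  have hD2 : ∑ a', Tstar s a' s' ≤ (Fintype.card A : ℝ) := by
    have := Finset.sum_le_sum (s := Finset.univ) fun a _ => hle a
    simpa using this
  refine ⟨by linarith, hD1, ?_⟩
  rw [← sub_div]
  exact div_le_div₀ (by linarith) (by linarith) (by linarith) hD2
end

section
/- Let A be a finite nonempty set, p and q probability mass functions on A, B a nonempty subset of A, and γ > 0. Suppose q(a₁) − q(a₂) ≥ γ for all a₁ ∈ B and a₂ ∈ A∖B, and suppose (1/2)·Σ_{a∈A} |p(a)−q(a)| < γ/2. Then every maximizer of p over A belongs to B. -/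
/-- Stability of the argmax under total variation error: if `q` has a
gap of at least `γ` between every `a₁ ∈ B` and `a₂ ∉ B`, and the total variation distance
between the probability mass functions `p` and `q` is less than `γ/2`, then every
maximizer of `p` lies in `B`. -/
theorem stmt_10 {A : Type*} [Fintype A] [Nonempty A]
    (p q : A → ℝ)
    (hpnn : ∀ a, 0 ≤ p a) (hpsum : ∑ a, p a = 1)
    (hqnn : ∀ a, 0 ≤ q a) (hqsum : ∑ a, q a = 1)
    (B : Finset A) (hB : B.Nonempty)
    (γ : ℝ) (hγ : 0 < γ)
    (hgap : ∀ a₁ ∈ B, ∀ a₂ ∉ B, γ ≤ q a₁ - q a₂)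
    (htv : (1 / 2) * ∑ a, |p a - q a| < γ / 2) :
    ∀ a₀ : A, (∀ a, p a ≤ p a₀) → a₀ ∈ B := by
  classical
  intro a₀ hmax
  by_contra h
  obtain ⟨b, hb⟩ := hB
  have hne : b ≠ a₀ := fun e => h (e ▸ hb)
  have h1 := hgap b hb a₀ h
  have h2 : ∑ a ∈ ({b, a₀} : Finset A), |p a - q a| ≤ ∑ a, |p a - q a| :=
    Finset.sum_le_sum_of_subset_of_nonneg (Finset.subset_univ _)
      (fun _ _ _ => abs_nonneg _)
  rw [Finset.sum_pair hne] at h2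
  have h3 := neg_abs_le (p b - q b)
  have h4 := le_abs_self (p a₀ - q a₀)
  have h5 := hmax b
  linarith
end

section
/- Let X and A be finite nonempty sets and η ∈ [0, 1/2). Suppose for each pair (x,x') ∈ X×X we are given a nonempty set A(x,x') ⊆ A and probability mass functions f*(·|x,x') and f(·|x,x') on A such that f*(a₁|x,x') − f*(a₂|x,x') ≥ (1−2η)/|A| for all a₁ ∈ A(x,x') and a₂ ∈ A∖A(x,x'). Let α(x,x') ∈ A be any maximizer of f(·|x,x'). Let P and P' be probability mass functions on X×X with P'(x,x') ≤ |A|·P(x,x') for all (x,x'). If Σ_{(x,x')} P(x,x')·‖f(·|x,x') − f*(·|x,x')‖_TV² ≤ B, then Σ_{(x,x')} P'(x,x')·1{α(x,x') ∉ A(x,x')} ≤ 4|A|³·B/(1−2η)². -/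
/-- From an expected squared total-variation error bound `B` for the
learned inverse dynamics `f` against the true posterior `f*` (under the data-collection
distribution `P`), and a margin `(1-2η)/|A|` separating shadow actions `A(x,x')` from
other actions in `f*`, the probability (under any distribution `P'` with density ratio at
most `|A|` w.r.t. `P`) that the argmax decoder `α` picks a non-shadow action is at most
`4|A|³ B /(1-2η)²`. -/
theorem stmt_11 {X A : Type*} [Fintype X] [Fintype A] [Nonempty X] [Nonempty A]
    [DecidableEq A]
    (η : ℝ) (hη0 : 0 ≤ η) (hη : η < 1 / 2)
    (Ash : X → X → Finset A) (hAsh : ∀ x x', (Ash x x').Nonempty)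
    (fstar f : X → X → A → ℝ)
    (hfstarnn : ∀ x x' a, 0 ≤ fstar x x' a) (hfstarsum : ∀ x x', ∑ a, fstar x x' a = 1)
    (hfnn : ∀ x x' a, 0 ≤ f x x' a) (hfsum : ∀ x x', ∑ a, f x x' a = 1)
    (hgap : ∀ x x', ∀ a₁ ∈ Ash x x', ∀ a₂ ∉ Ash x x',
      (1 - 2 * η) / (Fintype.card A : ℝ) ≤ fstar x x' a₁ - fstar x x' a₂)
    (α : X → X → A) (hα : ∀ x x' a, f x x' a ≤ f x x' (α x x'))
    (P P' : X → X → ℝ)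
    (hPnn : ∀ x x', 0 ≤ P x x') (hPsum : ∑ x, ∑ x', P x x' = 1)
    (hP'nn : ∀ x x', 0 ≤ P' x x') (hP'sum : ∑ x, ∑ x', P' x x' = 1)
    (hratio : ∀ x x', P' x x' ≤ (Fintype.card A : ℝ) * P x x')
    (B : ℝ)
    (hB : ∑ x, ∑ x', P x x' *
        ((1 / 2) * ∑ a, |f x x' a - fstar x x' a|) ^ 2 ≤ B) :
    ∑ x, ∑ x', P' x x' * (if α x x' ∉ Ash x x' then (1 : ℝ) else 0)
      ≤ 4 * (Fintype.card A : ℝ) ^ 3 * B / (1 - 2 * η) ^ 2 := by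
  have hn : (0 : ℝ) < Fintype.card A := by exact_mod_cast Fintype.card_pos
  have hc : 0 < 1 - 2 * η := by linarith
  have key : ∀ x x', P' x x' * (if α x x' ∉ Ash x x' then (1 : ℝ) else 0) ≤
      (4 * (Fintype.card A : ℝ) ^ 3 / (1 - 2 * η) ^ 2) *
        (P x x' * ((1 / 2) * ∑ a, |f x x' a - fstar x x' a|) ^ 2) := by
    intro x x'
    have hP := hPnn x x'
    split_ifs with h; swap
    · obtain ⟨b, hb⟩ := hAsh x x'
      have hne : b ≠ α x x' := fun e => h (e ▸ hb)
      have h1 : ∑ a ∈ {b, α x x'}, |f x x' a - fstar x x' a| ≤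
          ∑ a, |f x x' a - fstar x x' a| :=
        Finset.sum_le_sum_of_subset_of_nonneg (Finset.subset_univ _)
          (fun _ _ _ => abs_nonneg _)
      rw [Finset.sum_pair hne] at h1
      have h2 := hgap x x' b hb _ h
      have h3 := hα x x' b
      have h4 := neg_abs_le (f x x' b - fstar x x' b)
      have h5 := le_abs_self (f x x' (α x x') - fstar x x' (α x x'))
      set S := ∑ a, |f x x' a - fstar x x' a|
      have h6 : (1 - 2 * η) / (Fintype.card A : ℝ) ≤ S := by linarith
      rw [div_le_iff₀ hn] at h6
      have h7 : (1 - 2 * η) ^ 2 ≤ (S * Fintype.card A) ^ 2 :=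
        pow_le_pow_left₀ hc.le h6 2
      have h8 : 1 ≤ (S * Fintype.card A) ^ 2 / (1 - 2 * η) ^ 2 := by
        rwa [one_le_div (by positivity)]
      calc P' x x' * 1 ≤ (Fintype.card A * P x x') * 1 := by linarith [hratio x x']
        _ ≤ (Fintype.card A * P x x') * ((S * Fintype.card A) ^ 2 / (1 - 2 * η) ^ 2) :=
          mul_le_mul_of_nonneg_left h8 (by positivity)
        _ = _ := by ring
    · rw [mul_zero]
      positivity
  calc _ ≤ ∑ x, ∑ x', (4 * (Fintype.card A : ℝ) ^ 3 / (1 - 2 * η) ^ 2) *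
        (P x x' * ((1 / 2) * ∑ a, |f x x' a - fstar x x' a|) ^ 2) :=
        Finset.sum_le_sum fun x _ => Finset.sum_le_sum fun x' _ => key x x'
    _ = (4 * (Fintype.card A : ℝ) ^ 3 / (1 - 2 * η) ^ 2) * ∑ x, ∑ x', 
        (P x x' * ((1 / 2) * ∑ a, |f x x' a - fstar x x' a|) ^ 2) := by
        simp only [Finset.mul_sum]
    _ ≤ (4 * (Fintype.card A : ℝ) ^ 3 / (1 - 2 * η) ^ 2) * B :=
        mul_le_mul_of_nonneg_left hB (by positivity)
    _ = _ := by ring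
end

section
/- Let X and A be finite nonempty sets, μ a probability mass function on X, and T : X×A → Δ(X). Define ρ(x') = Σ_{x} Σ_{a} μ(x)·(1/|A|)·T(x'|x,a), D(x,a,x') = μ(x)·(T(x'|x,a)+ρ(x'))/(2|A|), D(a,x') = Σ_x D(x,a,x'), and, for (a,x') with D(a,x') > 0, the coupling D_c(x₁,x₂,a,x') = [D(x₁,a,x')·D(x₂,a,x')/D(a,x')²]·ρ(x')/|A| (and D_c = 0 when D(a,x') = 0). Then: (i) Σ_{a∈A} D(a,x') = ρ(x') for every x'; (ii) D(a,x') ≥ ρ(x')/(2|A|) for every a,x'; (iii) Σ_{x₁} D_c(x₁,x₂,a,x') ≤ 2·D(x₂,a,x') and Σ_{x₂} D_c(x₁,x₂,a,x') ≤ 2·D(x₁,a,x') for all x₁,x₂,a,x'. -/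
/-- Properties of the classification distribution `D` and the coupling
distribution `D_c`: (i) `∑_a D(a,x') = ρ(x')`; (ii) `D(a,x') ≥ ρ(x')/(2|A|)`;
(iii) both marginals of `D_c` over one of the two first observations are bounded by
twice the corresponding `D` value. -/
theorem stmt_14 {X A : Type*} [Fintype X] [Fintype A] [Nonempty X] [Nonempty A]
    (μ : X → ℝ) (hμnn : ∀ x, 0 ≤ μ x) (hμsum : ∑ x, μ x = 1)
    (T : X → A → X → ℝ) (hTnn : ∀ x a x', 0 ≤ T x a x')
    (hTsum : ∀ x a, ∑ x', T x a x' = 1)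
    (ρ : X → ℝ)
    (hρ : ∀ x', ρ x' = ∑ x, ∑ a, μ x * (Fintype.card A : ℝ)⁻¹ * T x a x')
    (D : X → A → X → ℝ)
    (hD : ∀ x a x',
      D x a x' = μ x * (T x a x' + ρ x') / (2 * (Fintype.card A : ℝ)))
    (Dm : A → X → ℝ) (hDm : ∀ a x', Dm a x' = ∑ x, D x a x')
    (Dc : X → X → A → X → ℝ)
    (hDc : ∀ x₁ x₂ a x', Dc x₁ x₂ a x' =
      if Dm a x' = 0 then 0
      else (D x₁ a x' * D x₂ a x' / (Dm a x') ^ 2) * ρ x' / (Fintype.card A : ℝ)) :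
    (∀ x', ∑ a, Dm a x' = ρ x') ∧
    (∀ a x', ρ x' / (2 * (Fintype.card A : ℝ)) ≤ Dm a x') ∧
    (∀ x₂ a x', ∑ x₁, Dc x₁ x₂ a x' ≤ 2 * D x₂ a x') ∧
    (∀ x₁ a x', ∑ x₂, Dc x₁ x₂ a x' ≤ 2 * D x₁ a x') := by
  have hn : (0 : ℝ) < (Fintype.card A : ℝ) := by exact_mod_cast Fintype.card_pos
  have hρnn : ∀ x', 0 ≤ ρ x' := by
    intro x'
    rw [hρ]
    refine Finset.sum_nonneg fun x _ => Finset.sum_nonneg fun a _ => ?_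
    exact mul_nonneg (mul_nonneg (hμnn x) (inv_nonneg.2 hn.le)) (hTnn x a x')
  have hDnn : ∀ x a x', 0 ≤ D x a x' := by
    intro x a x'
    rw [hD]
    exact div_nonneg (mul_nonneg (hμnn x) (add_nonneg (hTnn x a x') (hρnn x')))
      (by positivity)
  have hDm2 : ∀ a x', Dm a x' =
      (∑ x, μ x * T x a x' + ρ x') / (2 * (Fintype.card A : ℝ)) := by
    intro a x'
    rw [hDm]
    simp only [hD]
    rw [← Finset.sum_div]
    simp only [mul_add, Finset.sum_add_distrib]
    rw [← Finset.sum_mul, hμsum, one_mul]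
  have hS : ∀ x', ∑ a, ∑ x, μ x * T x a x' = (Fintype.card A : ℝ) * ρ x' := by
    intro x'
    rw [hρ, Finset.sum_comm, Finset.mul_sum]
    refine Finset.sum_congr rfl fun x _ => ?_
    rw [Finset.mul_sum]
    refine Finset.sum_congr rfl fun a _ => ?_
    field_simp
  have h2 : ∀ a x', ρ x' / (2 * (Fintype.card A : ℝ)) ≤ Dm a x' := by
    intro a x'
    rw [hDm2]
    have : 0 ≤ ∑ x, μ x * T x a x' :=
      Finset.sum_nonneg fun x _ => mul_nonneg (hμnn x) (hTnn x a x')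
    gcongr
    linarith
  have h3 : ∀ x₂ a x', ∑ x₁, Dc x₁ x₂ a x' ≤ 2 * D x₂ a x' := by
    intro x₂ a x'
    simp only [hDc]
    by_cases h0 : Dm a x' = 0
    · simp only [h0, if_true, Finset.sum_const_zero]
      linarith [hDnn x₂ a x']
    · simp only [h0, if_false]
      have hpos : 0 < Dm a x' := lt_of_le_of_ne
        (by rw [hDm]; exact Finset.sum_nonneg fun x _ => hDnn x a x') (Ne.symm h0)
      have e : ∑ x₁, D x₁ a x' * D x₂ a x' / (Dm a x') ^ 2 * ρ x' / (Fintype.card A : ℝ)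
          = D x₂ a x' * (ρ x' / (Fintype.card A : ℝ) / Dm a x') := by
        rw [← Finset.sum_div, ← Finset.sum_mul, ← Finset.sum_div, ← Finset.sum_mul, ← hDm]
        field_simp
      rw [e, mul_comm 2]
      refine mul_le_mul_of_nonneg_left ?_ (hDnn x₂ a x')
      rw [div_le_iff₀ hpos]
      have h := h2 a x'
      have e2 : ρ x' / (Fintype.card A : ℝ) = 2 * (ρ x' / (2 * (Fintype.card A : ℝ))) := by
        field_simp
      linarith
  refine ⟨?_, h2, h3, ?_⟩
  · intro x'
    simp only [hDm2]
    rw [← Finset.sum_div, Finset.sum_add_distrib, hS]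
    simp only [Finset.sum_const, Finset.card_univ, nsmul_eq_mul]
    field_simp
    ring
  · intro x₁ a x'
    refine le_trans (le_of_eq ?_) (h3 x₁ a x')
    refine Finset.sum_congr rfl fun x₂ _ => ?_
    rw [hDc, hDc, mul_comm (D x₁ a x')]
end

section
/- Let X and A be finite nonempty sets and N ∈ ℕ. Let D be a probability mass function on X×A×X and D_c a nonnegative function on X×X×A×X satisfying Σ_{x₂} D_c(x₁,x₂,a,x') ≤ 2·D(x₁,a,x') and Σ_{x₁} D_c(x₁,x₂,a,x') ≤ 2·D(x₂,a,x') for all x₁,x₂,a,x'. Let φ̂ : X → {1,…,N}, ĝ : {1,…,N}×A×X → ℝ, and g* : X×A×X → ℝ be functions such that Σ_{(x,a,x')} D(x,a,x')·|ĝ(φ̂(x),a,x') − g*(x,a,x')| ≤ Δ. Then Σ_{(x₁,x₂,a,x')} D_c(x₁,x₂,a,x')·1{φ̂(x₁) = φ̂(x₂)}·|g*(x₁,a,x') − g*(x₂,a,x')| ≤ 4Δ. -/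
/-- Coupling lemma: if `ĝ ∘ φ̂` approximates `g*` in expected absolute
error `Δ` under `D`, and the coupling `D_c` has both one-sided marginals bounded by
`2·D`, then the expected discrepancy of `g*` between two observations placed in the same
cluster by `φ̂` is at most `4Δ`. -/
theorem stmt_15 {X A : Type*} [Fintype X] [Fintype A] [Nonempty X] [Nonempty A]
    (N : ℕ)
    (D : X → A → X → ℝ) (hDnn : ∀ x a x', 0 ≤ D x a x')
    (hDsum : ∑ x, ∑ a, ∑ x', D x a x' = 1)
    (Dc : X → X → A → X → ℝ) (hDcnn : ∀ x₁ x₂ a x', 0 ≤ Dc x₁ x₂ a x')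
    (hDc1 : ∀ x₁ a x', ∑ x₂, Dc x₁ x₂ a x' ≤ 2 * D x₁ a x')
    (hDc2 : ∀ x₂ a x', ∑ x₁, Dc x₁ x₂ a x' ≤ 2 * D x₂ a x')
    (φhat : X → Fin N) (ghat : Fin N → A → X → ℝ) (gstar : X → A → X → ℝ)
    (Δ : ℝ)
    (hΔ : ∑ x, ∑ a, ∑ x', D x a x' * |ghat (φhat x) a x' - gstar x a x'| ≤ Δ) :
    ∑ x₁, ∑ x₂, ∑ a, ∑ x',
      Dc x₁ x₂ a x' *
        (if φhat x₁ = φhat x₂ then |gstar x₁ a x' - gstar x₂ a x'| else 0)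
    ≤ 4 * Δ := by
  have key : ∀ E : X → X → A → X → ℝ,
      (∀ x₁ a x', ∑ x₂, E x₁ x₂ a x' ≤ 2 * D x₁ a x') →
      ∑ x₁, ∑ x₂, ∑ a, ∑ x', E x₁ x₂ a x' * |ghat (φhat x₁) a x' - gstar x₁ a x'|
        ≤ 2 * Δ := by
    intro E hE
    refine le_trans ?_ (mul_le_mul_of_nonneg_left hΔ (by norm_num : (0:ℝ) ≤ 2))
    rw [Finset.mul_sum]
    refine Finset.sum_le_sum fun x₁ _ => ?_
    rw [Finset.sum_comm, Finset.mul_sum]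
    refine Finset.sum_le_sum fun a _ => ?_
    rw [Finset.sum_comm, Finset.mul_sum]
    refine Finset.sum_le_sum fun x' _ => ?_
    rw [← Finset.sum_mul, ← mul_assoc]
    exact mul_le_mul_of_nonneg_right (hE x₁ a x') (abs_nonneg _)
  have h1 := key Dc hDc1
  have h2 := key (fun x₁ x₂ => Dc x₂ x₁) hDc2
  rw [Finset.sum_comm] at h2
  have h3 : ∑ x₁, ∑ x₂, ∑ a, ∑ x',
      Dc x₁ x₂ a x' *
        (if φhat x₁ = φhat x₂ then |gstar x₁ a x' - gstar x₂ a x'| else 0)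
      ≤ ∑ x₁, ∑ x₂, ∑ a, ∑ x', (Dc x₁ x₂ a x' * |ghat (φhat x₁) a x' - gstar x₁ a x'|
        + Dc x₁ x₂ a x' * |ghat (φhat x₂) a x' - gstar x₂ a x'|) := by
    refine Finset.sum_le_sum fun x₁ _ => Finset.sum_le_sum fun x₂ _ =>
      Finset.sum_le_sum fun a _ => Finset.sum_le_sum fun x' _ => ?_
    rw [← mul_add]
    refine mul_le_mul_of_nonneg_left ?_ (hDcnn _ _ _ _)
    split_ifs with h
    · rw [h, abs_sub_comm (ghat (φhat x₂) a x') (gstar x₁ a x')]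
      exact abs_sub_le _ _ _
    · positivity
  simp only [Finset.sum_add_distrib] at h3
  linarith
end

section
/- Let X, A be finite nonempty sets and S* a finite set. Let μ be a probability mass function on X, T : X×A → Δ(X), and φ* : X → S* a labeling such that for every a ∈ A and all x₁,x₂ ∈ X with φ*(x₁) ≠ φ*(x₂): (1/2)·Σ_{x'} |T(x'|x₁,a) − T(x'|x₂,a)| ≥ Γ, where Γ > 0. Define ρ(x') = Σ_x Σ_a μ(x)·(1/|A|)·T(x'|x,a), D(x,a,x') = μ(x)·(T(x'|x,a)+ρ(x'))/(2|A|), D(a,x') = Σ_x D(x,a,x'), the coupling D_c(x₁,x₂,a,x') = [D(x₁,a,x')·D(x₂,a,x')/D(a,x')²]·ρ(x')/|A| (set to 0 when D(a,x') = 0), and g*(x,a,x') = T(x'|x,a)/(T(x'|x,a)+ρ(x')) (set to 0 when the denominator is 0). Let N ∈ ℕ, φ̂ : X → {1,…,N}, and ĝ : {1,…,N}×A×X → ℝ satisfy Σ_{(x,a,x')} D(x,a,x')·|ĝ(φ̂(x),a,x') − g*(x,a,x')| ≤ Δ. Then Σ_{x₁,x₂} μ(x₁)·μ(x₂)·1{φ*(x₁)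 ≠ φ*(x₂) and φ̂(x₁) = φ̂(x₂)} ≤ 8·|A|²·Δ/Γ. -/
/-- One-sided clustering error bound: if the transition distributions
of observations with different latent labels are separated by `Γ` in total variation,
and `ĝ ∘ φ̂` approximates the Bayes classifier `g*` within expected absolute error `Δ`
under the classification distribution `D`, then the probability (under `μ ⊗ μ`) that two
observations with different latent labels are placed in the same cluster is at most
`8|A|²Δ/Γ`. -/
theorem stmt_16 {X A Sstar : Type*} [Fintype X] [Fintype A] [Fintype Sstar]
    [Nonempty X] [Nonempty A] [DecidableEq Sstar]
    (μ : X → ℝ) (hμnn : ∀ x, 0 ≤ μ x) (hμsum : ∑ x, μ x = 1)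
    (T : X → A → X → ℝ) (hTnn : ∀ x a x', 0 ≤ T x a x')
    (hTsum : ∀ x a, ∑ x', T x a x' = 1)
    (φstar : X → Sstar) (Γ : ℝ) (hΓ : 0 < Γ)
    (hmargin : ∀ (a : A) (x₁ x₂ : X), φstar x₁ ≠ φstar x₂ →
      Γ ≤ (1 / 2) * ∑ x', |T x₁ a x' - T x₂ a x'|)
    (ρ : X → ℝ)
    (hρ : ∀ x', ρ x' = ∑ x, ∑ a, μ x * (Fintype.card A : ℝ)⁻¹ * T x a x')
    (D : X → A → X → ℝ)
    (hD : ∀ x a x',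
      D x a x' = μ x * (T x a x' + ρ x') / (2 * (Fintype.card A : ℝ)))
    (gstar : X → A → X → ℝ)
    (hgstar : ∀ x a x',
      gstar x a x' = if T x a x' + ρ x' = 0 then 0
        else T x a x' / (T x a x' + ρ x'))
    (N : ℕ) (φhat : X → Fin N) (ghat : Fin N → A → X → ℝ)
    (Δ : ℝ)
    (hΔ : ∑ x, ∑ a, ∑ x', D x a x' * |ghat (φhat x) a x' - gstar x a x'| ≤ Δ) :
    ∑ x₁, ∑ x₂,
      (if φstar x₁ ≠ φstar x₂ ∧ φhat x₁ = φhat x₂ then μ x₁ * μ x₂ else 0)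
    ≤ 8 * (Fintype.card A : ℝ) ^ 2 * Δ / Γ := by
  classical
  set n : ℝ := (Fintype.card A : ℝ) with hn
  have hn1 : (1 : ℝ) ≤ n := by
    have : 1 ≤ Fintype.card A := Fintype.card_pos
    rw [hn]
    exact_mod_cast this
  have hn0 : 0 < n := by linarith
  have hnρ : ∀ x', n * ρ x' = ∑ x, ∑ a, μ x * T x a x' := by
    intro x'
    rw [hρ, Finset.mul_sum]
    refine Finset.sum_congr rfl fun x _ => ?_
    rw [Finset.mul_sum]
    refine Finset.sum_congr rfl fun a _ => ?_
    field_simp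
  have hTa : ∀ x a x', μ x * T x a x' ≤ n * ρ x' := by
    intro x a x'
    rw [hnρ]
    refine le_trans ?_ (Finset.single_le_sum (f := fun x => ∑ a, μ x * T x a x')
      (fun x _ => Finset.sum_nonneg fun a _ => mul_nonneg (hμnn x) (hTnn x a x'))
      (Finset.mem_univ x))
    exact Finset.single_le_sum (f := fun a => μ x * T x a x')
      (fun a _ => mul_nonneg (hμnn x) (hTnn x a x')) (Finset.mem_univ a)
  have hTs : ∀ a x', ∑ x, μ x * T x a x' ≤ n * ρ x' := by
    intro a x'
    rw [hnρ]
    refine Finset.sum_le_sum fun x _ => ?_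
    exact Finset.single_le_sum (f := fun a => μ x * T x a x')
      (fun a _ => mul_nonneg (hμnn x) (hTnn x a x')) (Finset.mem_univ a)
  have hρnn : ∀ x', 0 ≤ ρ x' := by
    intro x'
    rw [hρ]
    exact Finset.sum_nonneg fun x _ => Finset.sum_nonneg fun a _ =>
      mul_nonneg (mul_nonneg (hμnn x) (by positivity)) (hTnn x a x')
  have hDnn : ∀ x a x', 0 ≤ D x a x' := by
    intro x a x'
    rw [hD]
    have := hμnn x
    have := hTnn x a x'
    have := hρnn x'
    positivity
  set e : X → A → X → ℝ := fun x a x' => |ghat (φhat x) a x' - gstar x a x'| with he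
  have henn : ∀ x a x', 0 ≤ e x a x' := fun x a x' => abs_nonneg _
  have hΔ0 : 0 ≤ Δ := le_trans (Finset.sum_nonneg fun x _ => Finset.sum_nonneg fun a _ =>
    Finset.sum_nonneg fun x' _ => mul_nonneg (hDnn x a x') (henn x a x')) hΔ
  set P : X → X → ℝ := fun x₁ x₂ =>
    (if φstar x₁ ≠ φstar x₂ ∧ φhat x₁ = φhat x₂ then μ x₁ * μ x₂ else 0) with hP
  have hPnn : ∀ x₁ x₂, 0 ≤ P x₁ x₂ := by
    intro x₁ x₂
    simp only [hP]
    split_ifs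
    · exact mul_nonneg (hμnn _) (hμnn _)
    · exact le_rfl
  have hM : ∀ a x', ∑ x, μ x * (T x a x' + ρ x') ≤ 2 * n * ρ x' := by
    intro a x'
    simp only [mul_add, Finset.sum_add_distrib]
    rw [← Finset.sum_mul, hμsum]
    nlinarith [hTs a x', hρnn x']
  have key : ∀ a x', ∑ x₁, ∑ x₂, P x₁ x₂ * |T x₁ a x' - T x₂ a x'|
      ≤ 8 * n ^ 2 * ∑ x, D x a x' * e x a x' := by
    intro a x'
    have hEnn : 0 ≤ ∑ x, D x a x' * e x a x' :=
      Finset.sum_nonneg fun x _ => mul_nonneg (hDnn x a x') (henn x a x')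
    rcases (hρnn x').eq_or_lt with h0 | hpos
    · have hz : ∀ x, μ x * T x a x' = 0 := fun x =>
        le_antisymm (by have := hTa x a x'; rw [← h0] at this; simpa using this)
          (mul_nonneg (hμnn x) (hTnn x a x'))
      have : ∑ x₁, ∑ x₂, P x₁ x₂ * |T x₁ a x' - T x₂ a x'| = 0 := by
        refine Finset.sum_eq_zero fun x₁ _ => Finset.sum_eq_zero fun x₂ _ => ?_
        simp only [hP]
        split_ifs
        · rcases mul_eq_zero.1 (hz x₁) with h1 | h1
          · simp [h1]
          · rcases mul_eq_zero.1 (hz x₂) with h2 | h2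
            · simp [h2]
            · simp [h1, h2]
        · simp
      rw [this]
      positivity
    · set w : X → ℝ := fun x => μ x * (T x a x' + ρ x') with hw
      have hwnn : ∀ x, 0 ≤ w x := fun x =>
        mul_nonneg (hμnn x) (add_nonneg (hTnn x a x') hpos.le)
      have hwD : ∀ x, w x = 2 * n * D x a x' := by
        intro x
        rw [hD]
        simp only [hw]
        field_simp
      have step : ∀ x₁ x₂, ρ x' * (P x₁ x₂ * |T x₁ a x' - T x₂ a x'|)
          ≤ w x₁ * w x₂ * (e x₁ a x' + e x₂ a x') := by
        intro x₁ x₂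
        simp only [hP]
        split_ifs with hc
        · have p1 : 0 < T x₁ a x' + ρ x' := by linarith [hTnn x₁ a x']
          have p2 : 0 < T x₂ a x' + ρ x' := by linarith [hTnn x₂ a x']
          have hg : |gstar x₁ a x' - gstar x₂ a x'| ≤ e x₁ a x' + e x₂ a x' := by
            simp only [he, hc.2]
            have := abs_sub_le (gstar x₁ a x') (ghat (φhat x₂) a x') (gstar x₂ a x')
            rwa [abs_sub_comm (gstar x₁ a x') (ghat (φhat x₂) a x')] at this
          have hid : ρ x' * |T x₁ a x' - T x₂ a x'| =
              (T x₁ a x' + ρ x') * (T x₂ a x' + ρ x') *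
                |gstar x₁ a x' - gstar x₂ a x'| := by
            rw [← abs_of_pos (mul_pos p1 p2), ← abs_mul]
            nth_rewrite 1 [← abs_of_pos hpos]
            rw [← abs_mul, hgstar, hgstar, if_neg p1.ne', if_neg p2.ne']
            congr 1
            field_simp
            ring
          calc ρ x' * (μ x₁ * μ x₂ * |T x₁ a x' - T x₂ a x'|)
              = μ x₁ * μ x₂ * (ρ x' * |T x₁ a x' - T x₂ a x'|) := by ring
            _ = w x₁ * w x₂ * |gstar x₁ a x' - gstar x₂ a x'| := by
                rw [hid]; simp only [hw]; ring
            _ ≤ _ := mul_le_mul_of_nonneg_left hg (mul_nonneg (hwnn _) (hwnn _))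
        · simp only [zero_mul, mul_zero]
          exact mul_nonneg (mul_nonneg (hwnn _) (hwnn _)) (add_nonneg (henn _ _ _) (henn _ _ _))
      have hsum : ρ x' * ∑ x₁, ∑ x₂, P x₁ x₂ * |T x₁ a x' - T x₂ a x'|
          ≤ 2 * ((∑ x, w x) * ∑ x, w x * e x a x') := by
        calc _ = ∑ x₁, ∑ x₂, ρ x' * (P x₁ x₂ * |T x₁ a x' - T x₂ a x'|) := by
              simp only [Finset.mul_sum]
          _ ≤ ∑ x₁, ∑ x₂, w x₁ * w x₂ * (e x₁ a x' + e x₂ a x') :=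
              Finset.sum_le_sum fun x₁ _ => Finset.sum_le_sum fun x₂ _ => step x₁ x₂
          _ = ∑ x₁, ∑ x₂, ((w x₁ * e x₁ a x') * w x₂ + w x₁ * (w x₂ * e x₂ a x')) := by
              refine Finset.sum_congr rfl fun x₁ _ => Finset.sum_congr rfl fun x₂ _ => ?_
              ring
          _ = _ := by
              simp only [Finset.sum_add_distrib, ← Finset.sum_mul_sum]
              ring
      have hwe : ∑ x, w x * e x a x' = 2 * n * ∑ x, D x a x' * e x a x' := by
        rw [Finset.mul_sum]
        refine Finset.sum_congr rfl fun x _ => ?_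
        rw [hwD]; ring
      rw [hwe] at hsum
      have h2 : (∑ x, w x) * (2 * n * ∑ x, D x a x' * e x a x') ≤
          (2 * n * ρ x') * (2 * n * ∑ x, D x a x' * e x a x') :=
        mul_le_mul_of_nonneg_right (hM a x') (by positivity)
      refine le_of_mul_le_mul_left ?_ hpos
      nlinarith [hsum, h2]
  have lower : ∀ a, 2 * Γ * ∑ x₁, ∑ x₂, P x₁ x₂ ≤
      ∑ x', ∑ x₁, ∑ x₂, P x₁ x₂ * |T x₁ a x' - T x₂ a x'| := by
    intro a
    have hcomm : ∑ x', ∑ x₁, ∑ x₂, P x₁ x₂ * |T x₁ a x' - T x₂ a x'| =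
        ∑ x₁, ∑ x₂, ∑ x', P x₁ x₂ * |T x₁ a x' - T x₂ a x'| := by
      rw [Finset.sum_comm]
      refine Finset.sum_congr rfl fun x₁ _ => ?_
      rw [Finset.sum_comm]
    rw [hcomm, Finset.mul_sum]
    refine Finset.sum_le_sum fun x₁ _ => ?_
    rw [Finset.mul_sum]
    refine Finset.sum_le_sum fun x₂ _ => ?_
    rw [← Finset.mul_sum]
    by_cases hc : φstar x₁ ≠ φstar x₂
    · have := hmargin a x₁ x₂ hc
      nlinarith [hPnn x₁ x₂]
    · have : P x₁ x₂ = 0 := by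
        simp only [hP]
        rw [if_neg (fun h => hc h.1)]
      simp [this]
  have total : n * (2 * Γ * ∑ x₁, ∑ x₂, P x₁ x₂) ≤ 8 * n ^ 2 * Δ := by
    calc n * (2 * Γ * ∑ x₁, ∑ x₂, P x₁ x₂) = ∑ _a : A, 2 * Γ * ∑ x₁, ∑ x₂, P x₁ x₂ := by
          rw [Finset.sum_const, nsmul_eq_mul, Finset.card_univ]
      _ ≤ ∑ a, ∑ x', 8 * n ^ 2 * ∑ x, D x a x' * e x a x' :=
          Finset.sum_le_sum fun a _ => (lower a).trans (Finset.sum_le_sum fun x' _ => key a x')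
      _ = 8 * n ^ 2 * ∑ x, ∑ a, ∑ x', D x a x' * e x a x' := by
          simp only [← Finset.mul_sum]
          congr 1
          rw [Finset.sum_comm (s := (Finset.univ : Finset X)) (t := (Finset.univ : Finset A))]
          refine Finset.sum_congr rfl fun a _ => ?_
          rw [Finset.sum_comm]
      _ ≤ _ := mul_le_mul_of_nonneg_left hΔ (by positivity)
  have hS : 0 ≤ ∑ x₁, ∑ x₂, P x₁ x₂ :=
    Finset.sum_nonneg fun x₁ _ => Finset.sum_nonneg fun x₂ _ => hPnn x₁ x₂
  rw [le_div_iff₀ hΓ]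
  have h3 : 0 ≤ Γ * ∑ x₁, ∑ x₂, P x₁ x₂ := mul_nonneg hΓ.le hS
  nlinarith [mul_nonneg (sub_nonneg.2 hn1) h3]
end

section
/- Let N ≥ 2 be an integer, X a finite set, μ a probability mass function on X, S a finite set with |S| = N, φ* : X → S a map with Pr_{x~μ}(φ*(x) = s) ≥ μ_min > 0 for every s ∈ S, and φ̂ : X → {1,…,N}. Suppose Pr_{(x₁,x₂)~μ⊗μ}(φ*(x₁) ≠ φ*(x₂) and φ̂(x₁) = φ̂(x₂)) ≤ Δ', where Δ' < (μ_min²/(4N²))·(1 − (1 − 2μ_min/N)²). Then there exists a bijection σ : S → {1,…,N} such that for every s ∈ S: Pr_{x~μ}(φ̂(x) = σ(s)) > 0 and Pr_{x~μ}(φ*(x) = s | φ̂(x) = σ(s)) ≥ 1 − 2N²Δ'/μ_min². -/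
/-- Initial-state cluster alignment: if each of the `N` latent states
has probability at least `μ_min` under `μ` via the labeling `φ*`, and the probability
that two independent observations with different latent labels share a learned cluster
is at most `Δ' < (μ_min²/(4N²))·(1 − (1 − 2μ_min/N)²)`, then there is a bijection `σ`
between latent states and clusters such that each cluster `σ s` has positive probability
and `Pr_{x∼μ}(φ*(x) = s ∣ φ̂(x) = σ s) ≥ 1 − 2N²Δ'/μ_min²`. -/
theorem stmt_17 {X S : Type*} [Fintype X] [Fintype S] [DecidableEq S]
    (N : ℕ) (hN : 2 ≤ N) (hcard : Fintype.card S = N)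
    (μ : X → ℝ) (hμnn : ∀ x, 0 ≤ μ x) (hμsum : ∑ x, μ x = 1)
    (φstar : X → S)
    (μmin : ℝ) (hμmin : 0 < μmin)
    (hlow : ∀ s : S, μmin ≤ ∑ x, (if φstar x = s then μ x else 0))
    (φhat : X → Fin N)
    (Δ' : ℝ)
    (hΔ'bound : ∑ x₁, ∑ x₂,
        (if φstar x₁ ≠ φstar x₂ ∧ φhat x₁ = φhat x₂ then μ x₁ * μ x₂ else 0) ≤ Δ')
    (hΔ'small : Δ' < (μmin ^ 2 / (4 * (N : ℝ) ^ 2)) *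
        (1 - (1 - 2 * μmin / (N : ℝ)) ^ 2)) :
    ∃ σ : S ≃ Fin N,
      ∀ s : S,
        0 < (∑ x, if φhat x = σ s then μ x else 0) ∧
        1 - 2 * (N : ℝ) ^ 2 * Δ' / μmin ^ 2 ≤
          (∑ x, if φstar x = s ∧ φhat x = σ s then μ x else 0) /
            (∑ x, if φhat x = σ s then μ x else 0) := by
  classical
  have hNpos : (0 : ℝ) < N := by
    have : 0 < N := by omega
    exact_mod_cast this
  set A : S → Fin N → ℝ := fun s i => ∑ x, if φstar x = s ∧ φhat x = i then μ x else 0 with hA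
  set B : S → Fin N → ℝ := fun s i => ∑ x, if φstar x ≠ s ∧ φhat x = i then μ x else 0 with hB
  have hq : ∀ s i, (∑ x, if φhat x = i then μ x else 0) = A s i + B s i := by
    intro s i
    simp only [hA, hB, ← Finset.sum_add_distrib]
    refine Finset.sum_congr rfl fun x _ => ?_
    by_cases h1 : φstar x = s <;> by_cases h2 : φhat x = i <;> simp [h1, h2]
  have hBnn : ∀ s i, 0 ≤ B s i := fun s i =>
    Finset.sum_nonneg fun x _ => by
      split_ifs
      · exact hμnn x
      · exact le_rfl
  have hAB : ∀ s i, A s i * B s i ≤ Δ' := by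
    intro s i
    refine le_trans ?_ hΔ'bound
    simp only [hA, hB, Finset.sum_mul_sum]
    refine Finset.sum_le_sum fun x _ => Finset.sum_le_sum fun y _ => ?_
    have hxy := mul_nonneg (hμnn x) (hμnn y)
    by_cases h1 : φstar x = s ∧ φhat x = i
    · by_cases h2 : φstar y ≠ s ∧ φhat y = i
      · have h3 : φstar x ≠ φstar y ∧ φhat x = φhat y :=
          ⟨fun h => h2.1 (h ▸ h1.1), h1.2.trans h2.2.symm⟩
        rw [if_pos h1, if_pos h2, if_pos h3]
      · rw [if_neg h2, mul_zero]
        split_ifs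
        · exact hxy
        · exact le_rfl
    · rw [if_neg h1, zero_mul]
      split_ifs
      · exact hxy
      · exact le_rfl
  have hAleB : ∀ s t i, s ≠ t → A t i ≤ B s i := by
    intro s t i hst
    refine Finset.sum_le_sum fun x _ => ?_
    by_cases h1 : φstar x = t ∧ φhat x = i
    · have h2 : φstar x ≠ s ∧ φhat x = i := ⟨fun h => hst (h.symm.trans h1.1), h1.2⟩
      rw [if_pos h1, if_pos h2]
    · rw [if_neg h1]
      split_ifs
      · exact hμnn x
      · exact le_rfl
  have hmax : ∀ s, ∃ i, μmin / N ≤ A s i := by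
    intro s
    by_contra! hcon
    have hsum : ∑ i, A s i = ∑ x, (if φstar x = s then μ x else 0) := by
      simp only [hA]
      rw [Finset.sum_comm]
      refine Finset.sum_congr rfl fun x _ => ?_
      by_cases h1 : φstar x = s <;> simp [h1]
    have hne : (Finset.univ : Finset (Fin N)).Nonempty := ⟨⟨0, by omega⟩, Finset.mem_univ _⟩
    have := Finset.sum_lt_sum_of_nonempty hne (fun i _ => hcon i)
    rw [hsum] at this
    simp only [Finset.sum_const, Finset.card_univ, Fintype.card_fin, nsmul_eq_mul] at this
    rw [mul_div_cancel₀ _ hNpos.ne'] at this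
    linarith [hlow s]
  choose f hf using hmax
  have hm : 0 < μmin / N := by positivity
  have hΔm : Δ' < (μmin / N) ^ 2 := by
    refine hΔ'small.trans_le ?_
    have e : μmin ^ 2 / (4 * (N : ℝ) ^ 2) = (μmin / N) ^ 2 / 4 := by field_simp
    rw [e]
    nlinarith [sq_nonneg (1 - 2 * μmin / (N : ℝ)), sq_nonneg (μmin / N),
      mul_nonneg (sq_nonneg (μmin / N)) (sq_nonneg (1 - 2 * μmin / (N : ℝ)))]
  have hinj : Function.Injective f := by
    intro s t hst
    by_contra hne
    have h1 := hAB s (f s)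
    have h2 := hAleB s t (f s) hne
    have h3 := hf s
    have h4 := hf t
    rw [← hst] at h4
    have h5 : μmin / N * (μmin / N) ≤ A s (f s) * B s (f s) :=
      mul_le_mul h3 (h4.trans h2) hm.le (hm.le.trans h3)
    nlinarith
  have hbij : Function.Bijective f :=
    (Fintype.bijective_iff_injective_and_card f).2 ⟨hinj, by simp [hcard]⟩
  refine ⟨Equiv.ofBijective f hbij, fun s => ?_⟩
  rw [Equiv.ofBijective_apply, hq s (f s)]
  change 0 < A s (f s) + B s (f s) ∧ _ ≤ A s (f s) / (A s (f s) + B s (f s))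
  have h1 := hAB s (f s)
  have h2 := hf s
  have h3 := hBnn s (f s)
  generalize A s (f s) = a at *
  generalize B s (f s) = b at *
  have ha : 0 < a := hm.trans_le h2
  have hab : 0 < a + b := by linarith
  refine ⟨hab, ?_⟩
  have hΔ0 : 0 ≤ Δ' := le_trans (mul_nonneg ha.le h3) h1
  have e : 2 * (N : ℝ) ^ 2 * Δ' / μmin ^ 2 = 2 * (Δ' / (μmin / N) ^ 2) := by field_simp
  rw [e]
  have e2 : a / (a + b) = 1 - b / (a + b) := by field_simp; ring
  have h4 : b / (a + b) ≤ Δ' / (μmin / N) ^ 2 := by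
    rw [div_le_div_iff₀ hab (by positivity)]
    have h5 : (μmin / N) ^ 2 ≤ a * (a + b) := by nlinarith
    have h6 : b * (μmin / N) ^ 2 ≤ b * (a * (a + b)) := mul_le_mul_of_nonneg_left h5 h3
    have h7 : a * b * (a + b) ≤ Δ' * (a + b) := mul_le_mul_of_nonneg_right h1 hab.le
    linarith
  have h8 : 0 ≤ Δ' / (μmin / N) ^ 2 := by positivity
  rw [e2]
  linarith
end
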